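/- arXiv:1006.0193 — 6 statements merged into one kernel-verified Lean document; each statement's English description precedes it below -/
import Mathlib

section
/- Let n ≥ 2, let c be a capacity function on the edges of the bidirected ring on n nodes, let H be a nonempty finite family of demands, and let D = max over f ∈ H of d(f). Suppose that for some real α ≥ 0 there exists a fractional routing φ of H whose load on every edge e is at most α·c(e). Then there exists an integral routing φ' of H whose load on every edge e is strictly less than α·c(e) + (3/2)·D. -/
open Finset

/-- A demand on the bidirected ring on `n` nodes: a pair of distinct nodes together
with a positive demand value. -/
structure Demand (n : ℕ) where
  s : ZMod n
  t : ZMod n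
  hst : s ≠ t
  d : ℝ
  hd : 0 < d

/-- The forward edge `F i` (from `i` to `i+1`) lies on the forward path from `s` to `t`. -/
def OnFwdPath (n : ℕ) (s t i : ZMod n) : Prop :=
  (i - s).val < (t - s).val

/-- The backward edge `B i` (from `i+1` to `i`) lies on the backward path from `s` to `t`. -/
def OnBwdPath (n : ℕ) (s t i : ZMod n) : Prop :=
  (t - s).val ≤ (i - s).val

instance (n : ℕ) (s t i : ZMod n) : Decidable (OnFwdPath n s t i) :=
  inferInstanceAs (Decidable (_ < _))

instance (n : ℕ) (s t i : ZMod n) : Decidable (OnBwdPath n s t i) :=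
  inferInstanceAs (Decidable (_ ≤ _))

/-- An edge of the bidirected ring: `(true, i)` is the forward edge `F i`
(from `i` to `i+1`), and `(false, i)` is the backward edge `B i` (from `i+1` to `i`). -/
abbrev RingEdge (n : ℕ) := Bool × ZMod n

/-- The load of a routing `φ` of the family of demands `f` on an edge of the ring. -/
def edgeLoad {n : ℕ} {ι : Type*} [Fintype ι] (f : ι → Demand n) (φ : ι → ℝ) :
    RingEdge n → ℝ
  | (true, i) => ∑ a, if OnFwdPath n (f a).s (f a).t i then φ a * (f a).d else 0
  | (false, i) => ∑ a, if OnBwdPath n (f a).s (f a).t i then (1 - φ a) * (f a).d else 0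

/-- `φ` is a fractional routing: all its values lie in `[0,1]`. -/
def IsFracRouting {ι : Type*} (φ : ι → ℝ) : Prop := ∀ a, 0 ≤ φ a ∧ φ a ≤ 1

/-- `φ` is an integral routing: each demand is routed entirely forward or entirely backward. -/
def IsIntRouting {ι : Type*} (φ : ι → ℝ) : Prop := ∀ a, φ a = 0 ∨ φ a = 1

/-- The demand indexed by `a` is split under `φ`. -/
def IsSplit {ι : Type*} (φ : ι → ℝ) (a : ι) : Prop := 0 < φ a ∧ φ a < 1

/-- Demands `f1 = (s1,t1)` and `f2 = (s2,t2)` are parallel (in this order): there are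
integers `1 ≤ a ≤ b < g ≤ n` with `t1 = s1 + a`, `t2 = s1 + b`, `s2 = s1 + g`. -/
def Parallel (n : ℕ) (f1 f2 : Demand n) : Prop :=
  ∃ a b g : ℕ, 1 ≤ a ∧ a ≤ b ∧ b < g ∧ g ≤ n ∧
    f1.t = f1.s + (a : ZMod n) ∧ f2.t = f1.s + (b : ZMod n) ∧ f2.s = f1.s + (g : ZMod n)

theorem onBwdPath_iff_not_onFwdPath (n : ℕ) (s t i : ZMod n) :
    OnBwdPath n s t i ↔ ¬ OnFwdPath n s t i :=
  not_lt.symm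

/-- The forward path in terms of natural-number representatives: it occupies the positions
`s.val, …, s.val + (t - s).val - 1`, read modulo `n`. -/
theorem onFwdPath_iff (n : ℕ) [NeZero n] (s t i : ZMod n) :
    OnFwdPath n s t i ↔
      (s.val ≤ i.val ∧ i.val < s.val + (t - s).val) ∨ i.val + n < s.val + (t - s).val := by
  have hl := ZMod.val_lt (t - s)
  have hs := ZMod.val_lt s
  have hi := ZMod.val_lt i
  unfold OnFwdPath
  rcases le_or_gt s.val i.val with h | h
  · rw [ZMod.val_sub h]
    omega
  · have hsi : (s - i).val = s.val - i.val := ZMod.val_sub h.le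
    have hne : NeZero (s - i) := ⟨fun h0 => by
      rw [h0, ZMod.val_zero] at hsi
      omega⟩
    have hv : (i - s).val = n - (s.val - i.val) := by
      rw [← neg_sub s i, ZMod.val_neg_of_ne_zero, hsi]
    rw [hv]
    omega

section Loads

variable {n : ℕ} {ι : Type*} [Fintype ι]

theorem edgeLoad_fwd_add_div (f : ι → Demand n) (φ y : ι → ℝ) (i : ZMod n) :
    edgeLoad f (fun a => φ a + y a / (f a).d) (true, i) =
      edgeLoad f φ (true, i) + ∑ a, if OnFwdPath n (f a).s (f a).t i then y a else 0 := by
  simp only [edgeLoad, ← sum_add_distrib]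
  refine sum_congr rfl fun a _ => ?_
  have := (f a).hd.ne'
  split_ifs
  · field_simp
  · simp

theorem edgeLoad_bwd_add_div (f : ι → Demand n) (φ y : ι → ℝ) (i : ZMod n) :
    edgeLoad f (fun a => φ a + y a / (f a).d) (false, i) =
      edgeLoad f φ (false, i) -
        (∑ a, y a - ∑ a, if OnFwdPath n (f a).s (f a).t i then y a else 0) := by
  simp only [edgeLoad, ← sum_sub_distrib, onBwdPath_iff_not_onFwdPath]
  refine sum_congr rfl fun a _ => ?_
  have := (f a).hd.ne'
  split_ifs
  · simp
  · field_simp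
    ring

/-- If the forward path of `a` is contained in that of `b` and both demands are split, then one
of them can be unsplit without increasing any load. -/
theorem exists_unsplit_of_fwdPath_subset (f : ι → Demand n) (φ : ι → ℝ)
    (hφ : IsFracRouting φ) {a b : ι} (hab : a ≠ b) (ha : IsSplit φ a) (hb : IsSplit φ b)
    (hsub : ∀ i, OnFwdPath n (f a).s (f a).t i → OnFwdPath n (f b).s (f b).t i) :
    ∃ φ' : ι → ℝ, IsFracRouting φ' ∧ (∀ e, edgeLoad f φ' e ≤ edgeLoad f φ e) ∧
      {x | IsSplit φ' x} ⊂ {x | IsSplit φ x} := by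
  classical
  have hda := (f a).hd
  have hdb := (f b).hd
  obtain ⟨δ, hδ, hδa, hδb, hδ'⟩ : ∃ δ : ℝ, 0 < δ ∧ δ / (f a).d ≤ 1 - φ a ∧ δ / (f b).d ≤ φ b ∧
      (δ / (f a).d = 1 - φ a ∨ δ / (f b).d = φ b) := by
    refine ⟨min ((1 - φ a) * (f a).d) (φ b * (f b).d),
      lt_min (mul_pos (sub_pos.2 ha.2) hda) (mul_pos hb.1 hdb), ?_, ?_, ?_⟩
    · rw [div_le_iff₀ hda]
      exact min_le_left _ _
    · rw [div_le_iff₀ hdb]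
      exact min_le_right _ _
    · rw [div_eq_iff hda.ne', div_eq_iff hdb.ne']
      exact min_choice _ _
  set y : ι → ℝ := fun c => (if c = a then δ else 0) - if c = b then δ else 0 with hy
  have hya : y a = δ := by simp [hy, hab]
  have hyb : y b = -δ := by simp [hy, hab.symm]
  have hyc : ∀ c, c ≠ a → c ≠ b → y c = 0 := fun c h₁ h₂ => by simp [hy, h₁, h₂]
  have hδa0 : 0 < δ / (f a).d := div_pos hδ hda
  have hδb0 : 0 < δ / (f b).d := div_pos hδ hdb
  have hsum : ∑ c, y c = 0 := by simp [hy]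
  have hsum' : ∀ i, (∑ c, if OnFwdPath n (f c).s (f c).t i then y c else 0) ≤ 0 := by
    intro i
    have : ∀ c, (if OnFwdPath n (f c).s (f c).t i then y c else 0) =
        (if c = a then (if OnFwdPath n (f a).s (f a).t i then δ else 0) else 0) -
          if c = b then (if OnFwdPath n (f b).s (f b).t i then δ else 0) else 0 := by
      intro c
      by_cases h₁ : c = a
      · subst h₁
        simp [hya, hab]
      · by_cases h₂ : c = b
        · subst h₂
          simp only [hyb, h₁, if_true, if_false]
          split_ifs <;> simp
        · simp [hyc c h₁ h₂, h₁, h₂]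
    simp only [this, sum_sub_distrib, sum_ite_eq', mem_univ, if_true]
    have := hsub i
    split_ifs <;> first | tauto | linarith
  refine ⟨fun c => φ c + y c / (f c).d, fun c => ?_, ?_, ?_⟩
  · rcases eq_or_ne c a with rfl | h₁
    · simp only [hya]
      constructor <;> linarith [ha.1]
    · rcases eq_or_ne c b with rfl | h₂
      · simp only [hyb, neg_div]
        constructor <;> linarith [hb.2]
      · simpa [hyc c h₁ h₂] using hφ c
  · rintro ⟨_ | _, i⟩
    · rw [edgeLoad_bwd_add_div]
      linarith [hsum' i]
    · rw [edgeLoad_fwd_add_div]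
      linarith [hsum' i]
  · refine (Set.ssubset_iff_of_subset fun c hc => ?_).2 ?_
    · rcases eq_or_ne c a with rfl | h₁
      · exact ha
      · rcases eq_or_ne c b with rfl | h₂
        · exact hb
        · simpa [IsSplit, hyc c h₁ h₂] using hc
    · rcases hδ' with h | h
      · exact ⟨a, ha, fun hc => by
          have := hc.2
          simp only [hya] at this
          linarith⟩
      · exact ⟨b, hb, fun hc => by
          have := hc.1
          simp only [hyb, neg_div] at this
          linarith⟩

/-- Every fractional routing can be uncrossed: without increasing any load, one can reach a
routing in which the forward paths of the split demands are pairwise not nested. -/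
theorem exists_uncrossed (f : ι → Demand n) (φ : ι → ℝ) (hφ : IsFracRouting φ) :
    ∃ φ' : ι → ℝ, IsFracRouting φ' ∧ (∀ e, edgeLoad f φ' e ≤ edgeLoad f φ e) ∧
      ∀ a b, IsSplit φ' a → IsSplit φ' b →
        (∀ i, OnFwdPath n (f a).s (f a).t i → OnFwdPath n (f b).s (f b).t i) → a = b := by
  induction hk : {x | IsSplit φ x}.ncard using Nat.strong_induction_on generalizing φ with
  | _ k ih =>
    by_cases h : ∀ a b, IsSplit φ a → IsSplit φ b →
        (∀ i, OnFwdPath n (f a).s (f a).t i → OnFwdPath n (f b).s (f b).t i) → a = b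
    · exact ⟨φ, hφ, fun _ => le_rfl, h⟩
    · push Not at h
      obtain ⟨a, b, ha, hb, hsub, hab⟩ := h
      obtain ⟨φ₁, hφ₁, hle, hss⟩ := exists_unsplit_of_fwdPath_subset f φ hφ hab ha hb hsub
      obtain ⟨φ₂, hφ₂, hle₂, h₂⟩ :=
        ih _ (hk ▸ Set.ncard_lt_ncard hss (Set.toFinite _)) φ₁ hφ₁ rfl
      exact ⟨φ₂, hφ₂, fun e => (hle₂ e).trans (hle e), h₂⟩

end Loads

/-- Greedy rounding: along the order given by a key `p`, each element receives either the
increment `u a` or `u a - d a`, in such a way that all sums over initial segments stay in a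
half-open interval of length `D`. -/
theorem exists_rounding_initialSegment {ι : Type*} (T : Finset ι) (p : ι → ℕ) (u d : ι → ℝ)
    {D : ℝ} (hD : 0 < D) (hu : ∀ a ∈ T, 0 ≤ u a) (hud : ∀ a ∈ T, u a ≤ d a)
    (hd : ∀ a ∈ T, d a ≤ D) :
    ∃ x : ι → ℝ, (∀ a ∈ T, x a = u a ∨ x a = u a - d a) ∧ (∀ a ∉ T, x a = 0) ∧
      ∀ U ⊆ T, (∀ a ∈ U, ∀ b ∈ T, p b ≤ p a → b ∈ U) →
        -(D / 2) < ∑ a ∈ U, x a ∧ ∑ a ∈ U, x a ≤ D / 2 := by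
  classical
  induction T using Finset.induction_on_max_value p with
  | empty =>
    refine ⟨0, by simp, by simp, fun U _ _ => ?_⟩
    simp only [Pi.zero_apply, sum_const_zero]
    constructor <;> linarith
  | insert a T haT hmax ih =>
    obtain ⟨x, hx, hx0, hseg⟩ := ih (fun b hb => hu b (mem_insert_of_mem hb))
      (fun b hb => hud b (mem_insert_of_mem hb)) (fun b hb => hd b (mem_insert_of_mem hb))
    obtain ⟨hS₁, hS₂⟩ := hseg T subset_rfl fun _ _ b hb _ => hb
    have hua := hu a (mem_insert_self a T)
    have huda := hud a (mem_insert_self a T)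
    have hda := hd a (mem_insert_self a T)
    obtain ⟨v, hv, hv₁, hv₂⟩ : ∃ v : ℝ, (v = u a ∨ v = u a - d a) ∧
        -(D / 2) < v + ∑ b ∈ T, x b ∧ v + ∑ b ∈ T, x b ≤ D / 2 := by
      rcases le_or_gt (u a + ∑ b ∈ T, x b) (D / 2) with h | h
      · exact ⟨u a, Or.inl rfl, by linarith, h⟩
      · exact ⟨u a - d a, Or.inr rfl, by linarith, by linarith⟩
    have hupd : ∀ U : Finset ι, a ∉ U → ∑ b ∈ U, Function.update x a v b = ∑ b ∈ U, x b :=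
      fun U hU => sum_congr rfl fun b hb =>
        Function.update_of_ne (ne_of_mem_of_not_mem hb hU) _ _
    refine ⟨Function.update x a v, fun b hb => ?_, fun b hb => ?_, fun U hU hUseg => ?_⟩
    · rcases eq_or_ne b a with rfl | h
      · simpa using hv
      · simpa [h] using hx b (mem_of_mem_insert_of_ne hb h)
    · rw [mem_insert, not_or] at hb
      simpa [hb.1] using hx0 b hb.2
    · by_cases haU : a ∈ U
      · have hUeq : U = insert a T := by
          refine hU.antisymm fun b hb => hUseg a haU b hb ?_
          rcases mem_insert.1 hb with rfl | hb
          · exact le_rfl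
          · exact hmax b hb
        rw [hUeq, sum_insert haT, hupd T haT, Function.update_self]
        exact ⟨hv₁, hv₂⟩
      · rw [hupd U haU]
        refine hseg U (fun b hb => mem_of_mem_insert_of_ne (hU hb) (fun h => haU (h ▸ hb)))
          fun b hb c hc => hUseg b hb c (mem_insert_of_mem hc)

/-- If a fractional routing of a nonempty family of demands has load at most
`α · c(e)` on every edge, then there is an integral routing with load strictly less than
`α · c(e) + (3/2) · D` on every edge, where `D` is the maximum demand value. -/
theorem stmt0 (n : ℕ) (hn : 2 ≤ n) (c : RingEdge n → ℝ) (hc : ∀ e, 0 ≤ c e)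
    {ι : Type*} [Fintype ι] [Nonempty ι] (f : ι → Demand n)
    (α : ℝ) (hα : 0 ≤ α) (φ : ι → ℝ) (hφ : IsFracRouting φ)
    (hload : ∀ e, edgeLoad f φ e ≤ α * c e) :
    ∃ ψ : ι → ℝ, IsIntRouting ψ ∧
      ∀ e, edgeLoad f ψ e <
        α * c e + 3/2 * (Finset.univ.sup' Finset.univ_nonempty fun a => (f a).d) := by
  classical
  have : NeZero n := ⟨by omega⟩
  set D := Finset.univ.sup' Finset.univ_nonempty fun a => (f a).d
  have hdD : ∀ a, (f a).d ≤ D := fun a => le_sup' (fun a => (f a).d) (mem_univ a)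
  have hD : 0 < D := (f (Classical.arbitrary ι)).hd.trans_le (hdD _)
  obtain ⟨φ', hφ', hle, hunc⟩ := exists_uncrossed f φ hφ
  set T : Finset ι := univ.filter (IsSplit φ') with hT
  have hmem : ∀ a, a ∈ T ↔ IsSplit φ' a := fun a => by simp [hT]
  set p : ι → ℕ := fun a => (f a).s.val with hp
  set q : ι → ℕ := fun a => p a + ((f a).t - (f a).s).val with hq
  have hpn : ∀ a, p a < n := fun a => ZMod.val_lt _
  have hqp : ∀ a, q a < p a + n := fun a => Nat.add_lt_add_left (ZMod.val_lt _) _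
  have hpq : ∀ a, p a ≤ q a := fun a => Nat.le_add_right _ _
  have hon : ∀ a i, OnFwdPath n (f a).s (f a).t i ↔
      (p a ≤ i.val ∧ i.val < q a) ∨ i.val + n < q a := fun a i => onFwdPath_iff n _ _ i
  have hmono : ∀ a ∈ T, ∀ b ∈ T, p a ≤ p b → q a ≤ q b := by
    intro a ha b hb hab
    by_contra! hlt
    have := hunc b a ((hmem b).1 hb) ((hmem a).1 ha) fun i => by
      rw [hon, hon]
      omega
    subst this
    exact lt_irrefl _ hlt
  have hwrap : ∀ a ∈ T, ∀ b ∈ T, q b ≤ q a + n := by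
    intro a ha b hb
    by_contra! hlt
    have := hunc a b ((hmem a).1 ha) ((hmem b).1 hb) fun i => by
      rw [hon, hon]
      have := hpn b
      have := ZMod.val_lt i
      omega
    subst this
    omega
  obtain ⟨x, hxT, hx0, hseg⟩ := exists_rounding_initialSegment T p
    (fun a => (1 - φ' a) * (f a).d) (fun a => (f a).d) hD
    (fun a _ => mul_nonneg (sub_nonneg.2 (hφ' a).2) (f a).hd.le)
    (fun a _ => mul_le_of_le_one_left (f a).hd.le (by linarith [(hφ' a).1]))
    (fun a _ => hdD a)
  have htot := hseg T subset_rfl fun _ _ b hb _ => hb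
  have hsegp : ∀ k : ℕ, _ := fun k => hseg (T.filter fun a => p a ≤ k) (filter_subset _ _) (by
    intro a ha b hb hba
    rw [mem_filter] at ha ⊢
    exact ⟨hb, hba.trans ha.2⟩)
  have hsegq : ∀ k : ℕ, _ := fun k => hseg (T.filter fun a => q a ≤ k) (filter_subset _ _) (by
    intro a ha b hb hba
    rw [mem_filter] at ha ⊢
    exact ⟨hb, (hmono b hb a ha.1 hba).trans ha.2⟩)
  have hxsum : ∑ a, x a = ∑ a ∈ T, x a :=
    (sum_subset (subset_univ T) fun a _ ha => hx0 a ha).symm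
  have hcover : ∀ i : ZMod n, (∑ a, if OnFwdPath n (f a).s (f a).t i then x a else 0) =
      ∑ a ∈ T with p a ≤ i.val, x a - ∑ a ∈ T with q a ≤ i.val, x a +
        (∑ a ∈ T, x a - ∑ a ∈ T with q a ≤ i.val + n, x a) := by
    intro i
    rw [← sum_subset (subset_univ T) fun a _ ha => by simp [hx0 a ha]]
    simp only [sum_filter, ← sum_sub_distrib, ← sum_add_distrib, hon]
    refine sum_congr rfl fun a _ => ?_
    have h₁ := hqp a
    have h₂ := hpq a
    split_ifs <;> first | (exfalso; omega) | ring
  have hcases : ∀ i : ZMod n, ∑ a ∈ T with q a ≤ i.val, x a = 0 ∨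
      ∑ a ∈ T with q a ≤ i.val + n, x a = ∑ a ∈ T, x a := by
    intro i
    rcases (T.filter fun a => q a ≤ i.val).eq_empty_or_nonempty with h | ⟨a, ha⟩
    · exact Or.inl (by rw [h, sum_empty])
    · rw [mem_filter] at ha
      refine Or.inr ?_
      rw [filter_true_of_mem fun b hb => ?_]
      have := hwrap a ha.1 b hb
      omega
  refine ⟨fun a => φ' a + x a / (f a).d, fun a => ?_, ?_⟩
  · have hd := (f a).hd.ne'
    by_cases ha : a ∈ T
    · rcases hxT a ha with h | h
      · right
        simp only [h]
        field_simp
        ring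
      · left
        simp only [h]
        field_simp
        ring
    · have hns : ¬ IsSplit φ' a := fun h => ha ((hmem a).2 h)
      simp only [hx0 a ha, zero_div, add_zero]
      rcases (hφ' a).1.eq_or_lt with h | h
      · exact Or.inl h.symm
      · exact Or.inr ((hφ' a).2.eq_of_not_lt fun h' => hns ⟨h, h'⟩)
  · rintro ⟨_ | _, i⟩
    · have := (hle (false, i)).trans (hload (false, i))
      have hP := hsegp i.val
      have hQ := hsegq i.val
      have hR := hsegq (i.val + n)
      rw [edgeLoad_bwd_add_div, hxsum, hcover]
      rcases hcases i with h | h <;> rw [h] at * <;> linarith [hP.1, hQ.2, hR.1, htot.1]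
    · have := (hle (true, i)).trans (hload (true, i))
      have hP := hsegp i.val
      have hQ := hsegq i.val
      have hR := hsegq (i.val + n)
      rw [edgeLoad_fwd_add_div, hcover]
      rcases hcases i with h | h <;> rw [h] at * <;> linarith [hP.2, hQ.1, hR.1, htot.2]
end

section
/- Let D > 0 be a real number, n ≥ 1 an integer, and x_1, …, x_n, y_1, …, y_n nonnegative real numbers with x_i + y_i ≤ D for every i. Then there exist real numbers w_1, …, w_n with w_i ∈ {y_i, −x_i} for every i, such that for every k with 0 ≤ k ≤ n the partial sum S_k = w_1 + ⋯ + w_k satisfies −D/2 < S_k ≤ D/2. -/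
/-- Given nonnegative reals `x_1,…,x_n, y_1,…,y_n` with `x i + y i ≤ D`
(indices written `0,…,n-1`), one can choose `w i ∈ {y i, -x i}` so that every prefix sum
lies in the half-open interval `(-D/2, D/2]`. -/
theorem stmt4 (D : ℝ) (hD : 0 < D) (n : ℕ) (hn : 1 ≤ n) (x y : ℕ → ℝ)
    (hx : ∀ i < n, 0 ≤ x i) (hy : ∀ i < n, 0 ≤ y i) (hxy : ∀ i < n, x i + y i ≤ D) :
    ∃ w : ℕ → ℝ, (∀ i < n, w i = y i ∨ w i = -x i) ∧
      ∀ k ≤ n, -D/2 < ∑ i ∈ Finset.range k, w i ∧ ∑ i ∈ Finset.range k, w i ≤ D/2 := by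
  -- Greedy choice: add `y i` whenever the sum stays at most `D / 2`, otherwise subtract `x i`.
  let S : ℕ → ℝ := fun k =>
    Nat.rec 0 (fun i s => if s + y i ≤ D / 2 then s + y i else s - x i) k
  have S_zero : S 0 = 0 := rfl
  have S_succ (i : ℕ) : S (i + 1) = if S i + y i ≤ D / 2 then S i + y i else S i - x i := rfl
  refine ⟨fun i => S (i + 1) - S i, fun i _ => ?_, fun k hk => ?_⟩
  · simp only [S_succ]
    split_ifs
    · left; ring
    · right; ring
  · rw [Finset.sum_range_sub, S_zero, sub_zero]
    induction k with
    | zero => constructor <;> linarith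
    | succ k ih =>
      obtain ⟨h₁, h₂⟩ := ih (by lia)
      have := hx k hk
      have := hy k hk
      have := hxy k hk
      rw [S_succ]
      split_ifs <;> constructor <;> linarith
end

section
/- Let n ≥ 2, let c be a capacity function on the edges of the bidirected ring on n nodes, let H be a finite family of demands, and let α ≥ 0 be real. If there exists a fractional routing φ of H whose load on every edge e is at most α·c(e), then there exists an integral routing of H whose load on every edge e is at most 2·α·c(e). (In particular, the optimal integral congestion is at most twice the optimal fractional congestion.) -/
open Finset

/-- If a routing `ψ` uses at most twice the fraction that `φ` uses in each direction, then it
at most doubles the load of every edge. -/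
theorem edgeLoad_le_two_mul {n : ℕ} {ι : Type*} [Fintype ι] (f : ι → Demand n) {φ ψ : ι → ℝ}
    (hfwd : ∀ a, ψ a ≤ 2 * φ a) (hbwd : ∀ a, 1 - ψ a ≤ 2 * (1 - φ a)) (e : RingEdge n) :
    edgeLoad f ψ e ≤ 2 * edgeLoad f φ e := by
  rcases e with ⟨_ | _, i⟩ <;> simp only [edgeLoad, Finset.mul_sum] <;>
    refine Finset.sum_le_sum fun a _ => ?_ <;> split_ifs
  · rw [← mul_assoc]
    exact mul_le_mul_of_nonneg_right (hbwd a) (f a).hd.le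
  · simp
  · rw [← mul_assoc]
    exact mul_le_mul_of_nonneg_right (hfwd a) (f a).hd.le
  · simp

/-- If a fractional routing has load at most `α · c(e)` on every edge, then
there is an integral routing with load at most `2 · α · c(e)` on every edge. -/
theorem stmt6 (n : ℕ) (hn : 2 ≤ n) (c : RingEdge n → ℝ) (hc : ∀ e, 0 ≤ c e)
    {ι : Type*} [Fintype ι] (f : ι → Demand n)
    (α : ℝ) (hα : 0 ≤ α) (φ : ι → ℝ) (hφ : IsFracRouting φ)
    (hload : ∀ e, edgeLoad f φ e ≤ α * c e) :
    ∃ ψ : ι → ℝ, IsIntRouting ψ ∧ ∀ e, edgeLoad f ψ e ≤ 2 * α * c e := by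
  refine ⟨fun a => if 1 / 2 ≤ φ a then 1 else 0, fun a => ?_, fun e => ?_⟩
  · by_cases h : 1 / 2 ≤ φ a
    · exact Or.inr (if_pos h)
    · exact Or.inl (if_neg h)
  · refine (edgeLoad_le_two_mul f (φ := φ) (fun a => ?_) (fun a => ?_) e).trans ?_
    · have := (hφ a).1
      split_ifs <;> linarith
    · have := (hφ a).2
      split_ifs <;> linarith
    · linarith [hload e]
end

section
/- Let n ≥ 2, let c be a capacity function on the edges of the bidirected ring on n nodes, let H be a finite family of demands, let ε > 0 and α' > 0 be real, and set c̄ = (Σ_e c(e))/n, the sum running over all 2n edges. If there exists a fractional routing of H whose load on every edge e is at most α'·c(e), then the number of demands f ∈ H with d(f) > (2/3)·ε·α'·c̄ is strictly less than (3/(2ε))·n. -/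
open Finset

/-- Every demand occupies at least one edge on each of its two paths, so the total load of a
fractional routing is at least the total demand. -/
lemma IsFracRouting.sum_demand_le_sum_edgeLoad {n : ℕ} [NeZero n] {ι : Type*} [Fintype ι]
    (f : ι → Demand n) {φ : ι → ℝ} (hφ : IsFracRouting φ) :
    ∑ a, (f a).d ≤ ∑ e : RingEdge n, edgeLoad f φ e := by
  rw [Fintype.sum_prod_type, Fintype.sum_bool]
  simp only [edgeLoad]
  rw [Finset.sum_comm, Finset.sum_comm (s := (Finset.univ : Finset (ZMod n))),
    ← Finset.sum_add_distrib]
  refine Finset.sum_le_sum fun a _ => ?_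
  have hd := (f a).hd.le
  have hφd : 0 ≤ φ a * (f a).d := mul_nonneg (hφ a).1 hd
  have hφd' : 0 ≤ (1 - φ a) * (f a).d := mul_nonneg (sub_nonneg.2 (hφ a).2) hd
  have hfwd : OnFwdPath n (f a).s (f a).t (f a).s := by
    simpa [OnFwdPath, Nat.pos_iff_ne_zero, sub_eq_zero] using (f a).hst.symm
  have hbwd : OnBwdPath n (f a).s (f a).t (f a).t := le_refl _
  have h₁ := Finset.single_le_sum
    (f := fun i => if OnFwdPath n (f a).s (f a).t i then φ a * (f a).d else 0)
    (fun i _ => by split_ifs <;> simp [hφd]) (Finset.mem_univ (f a).s)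
  have h₂ := Finset.single_le_sum
    (f := fun i => if OnBwdPath n (f a).s (f a).t i then (1 - φ a) * (f a).d else 0)
    (fun i _ => by split_ifs <;> simp [hφd']) (Finset.mem_univ (f a).t)
  simp only [hfwd, hbwd, if_true] at h₁ h₂
  linarith

/-- If a fractional routing has load at most `α' · c(e)` on every edge, then
the number of demands of value greater than `(2/3)·ε·α'·c̄` is strictly less than
`(3/(2ε))·n`, where `c̄ = (Σ_e c(e))/n`. -/
theorem stmt8 (n : ℕ) (hn : 2 ≤ n) [NeZero n] (c : RingEdge n → ℝ) (hc : ∀ e, 0 ≤ c e)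
    {ι : Type*} [Fintype ι] (f : ι → Demand n)
    (ε α' : ℝ) (hε : 0 < ε) (hα' : 0 < α')
    (φ : ι → ℝ) (hφ : IsFracRouting φ)
    (hload : ∀ e, edgeLoad f φ e ≤ α' * c e) :
    ((Finset.univ.filter fun a : ι =>
        2/3 * ε * α' * ((∑ e : RingEdge n, c e) / n) < (f a).d).card : ℝ)
      < 3 / (2 * ε) * n := by
  have hn0 : (0 : ℝ) < n := by exact_mod_cast (by lia : 0 < n)
  set C : ℝ := ∑ e : RingEdge n, c e
  set S := Finset.univ.filter fun a : ι => 2/3 * ε * α' * (C / n) < (f a).d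
  rcases S.eq_empty_or_nonempty with hempty | hne
  · rw [hempty, Finset.card_empty, Nat.cast_zero]
    positivity
  have htotal : ∑ a ∈ S, (f a).d ≤ α' * C := calc
    ∑ a ∈ S, (f a).d ≤ ∑ a, (f a).d :=
      Finset.sum_le_univ_sum_of_nonneg fun a => (f a).hd.le
    _ ≤ ∑ e : RingEdge n, edgeLoad f φ e := hφ.sum_demand_le_sum_edgeLoad f
    _ ≤ ∑ e : RingEdge n, α' * c e := Finset.sum_le_sum fun e _ => hload e
    _ = α' * C := (Finset.mul_sum _ _ _).symm
  have hpos : 0 < α' * C := (Finset.sum_pos (fun a _ => (f a).hd) hne).trans_le htotal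
  have hlarge : S.card * (2/3 * ε * α' * (C / n)) < α' * C := by
    refine lt_of_lt_of_le ?_ htotal
    rw [← nsmul_eq_mul, ← Finset.sum_const]
    exact Finset.sum_lt_sum_of_nonempty hne fun a ha => (Finset.mem_filter.1 ha).2
  have hratio : S.card * (2/3 * ε / n) < 1 := by
    refine lt_of_mul_lt_mul_right ?_ hpos.le
    calc S.card * (2/3 * ε / n) * (α' * C) = S.card * (2/3 * ε * α' * (C / n)) := by ring
      _ < 1 * (α' * C) := by rwa [one_mul]
  calc (S.card : ℝ) < 1 / (2/3 * ε / n) := (lt_div_iff₀ (by positivity)).2 hratio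
    _ = 3 / (2 * ε) * n := by field_simp
end

section
/- Let n ≥ 2, let c be a capacity function on the edges of the bidirected ring on n nodes, let H be a finite family of demands, let ε > 0 and α' > 0 be real, and set c̄ = (Σ_e c(e))/n, the sum running over all 2n edges. Let ψ be an integral routing of H whose load on every edge e is at most α'·c(e). Then the number of demands f ∈ H with d(f) > (2/3)·ε·α'·c̄ that ψ routes along a path containing at least n/2 edges is strictly less than 3/ε. -/
open Finset

/-- The number of edges of the path along which the integral routing `ψ` routes the
demand indexed by `a`: the forward path if `ψ a = 1`, the backward path otherwise. -/
noncomputable def routedLen {n : ℕ} {ι : Type*} (f : ι → Demand n) (ψ : ι → ℝ) (a : ι) : ℕ :=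
  if ψ a = 1 then ((f a).t - (f a).s).val else n - ((f a).t - (f a).s).val

theorem card_filter_val_sub_lt {n : ℕ} [NeZero n] (s : ZMod n) {k : ℕ} (hk : k ≤ n) :
    (univ.filter fun i : ZMod n => (i - s).val < k).card = k := by
  refine (Finset.card_bij (t := Finset.range k) (fun i _ => (i - s).val) ?_ ?_ ?_).trans
    (Finset.card_range k)
  · intro i hi
    simpa using hi
  · intro i _ j _ hij
    exact sub_left_injective (ZMod.val_injective n hij)
  · intro m hm
    have hm' : m < k := Finset.mem_range.mp hm
    have hv : ((m : ZMod n) + s - s).val = m := by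
      rw [add_sub_cancel_right, ZMod.val_natCast_of_lt (hm'.trans_le hk)]
    exact ⟨m + s, by simpa only [Finset.mem_filter, Finset.mem_univ, true_and, hv] using hm', hv⟩

theorem card_filter_le_val_sub {n : ℕ} [NeZero n] (s : ZMod n) {k : ℕ} (hk : k ≤ n) :
    (univ.filter fun i : ZMod n => k ≤ (i - s).val).card = n - k := by
  have h := Finset.card_filter_add_card_filter_not (s := (univ : Finset (ZMod n)))
    (fun i => (i - s).val < k)
  simp only [not_lt] at h
  rw [card_filter_val_sub_lt s hk, Finset.card_univ, ZMod.card] at h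
  omega

/-- The total load of an integral routing is the sum of value times path length. -/
theorem sum_edgeLoad {n : ℕ} [NeZero n] {ι : Type*} [Fintype ι] (f : ι → Demand n)
    {ψ : ι → ℝ} (hψ : IsIntRouting ψ) :
    ∑ e : RingEdge n, edgeLoad f ψ e = ∑ a, (f a).d * routedLen f ψ a := by
  rw [Fintype.sum_prod_type, Fintype.sum_bool]
  simp only [edgeLoad]
  rw [Finset.sum_comm, Finset.sum_comm (s := (univ : Finset (ZMod n))),
    ← Finset.sum_add_distrib]
  refine Finset.sum_congr rfl fun a _ => ?_
  have hk : ((f a).t - (f a).s).val ≤ n := (ZMod.val_lt _).le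
  rw [← Finset.sum_filter, ← Finset.sum_filter, Finset.sum_const, Finset.sum_const]
  have hF : (univ.filter fun i => OnFwdPath n (f a).s (f a).t i).card =
      ((f a).t - (f a).s).val := card_filter_val_sub_lt _ hk
  have hB : (univ.filter fun i => OnBwdPath n (f a).s (f a).t i).card =
      n - ((f a).t - (f a).s).val := card_filter_le_val_sub _ hk
  rw [hF, hB, routedLen, nsmul_eq_mul, nsmul_eq_mul]
  rcases hψ a with h | h <;> simp [h, mul_comm]

/-- If an integral routing `ψ` has load at most `α' · c(e)` on every edge,
then the number of demands of value greater than `(2/3)·ε·α'·c̄` that `ψ` routes along a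
path with at least `n/2` edges is strictly less than `3/ε`, where `c̄ = (Σ_e c(e))/n`. -/
theorem stmt9 (n : ℕ) (hn : 2 ≤ n) [NeZero n] (c : RingEdge n → ℝ) (hc : ∀ e, 0 ≤ c e)
    {ι : Type*} [Fintype ι] (f : ι → Demand n)
    (ε α' : ℝ) (hε : 0 < ε) (hα' : 0 < α')
    (ψ : ι → ℝ) (hψ : IsIntRouting ψ)
    (hload : ∀ e, edgeLoad f ψ e ≤ α' * c e) :
    ((Finset.univ.filter fun a : ι =>
        2/3 * ε * α' * ((∑ e : RingEdge n, c e) / n) < (f a).d ∧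
        (n : ℝ) / 2 ≤ (routedLen f ψ a : ℝ)).card : ℝ)
      < 3 / ε := by
  set S := Finset.univ.filter fun a : ι =>
        2/3 * ε * α' * ((∑ e : RingEdge n, c e) / n) < (f a).d ∧
        (n : ℝ) / 2 ≤ (routedLen f ψ a : ℝ) with hS
  set C := (∑ e : RingEdge n, c e) / n with hC
  have hn0 : (0 : ℝ) < n := by exact_mod_cast (by omega : 0 < n)
  have hC0 : 0 ≤ C := div_nonneg (Finset.sum_nonneg fun e _ => hc e) hn0.le
  rcases S.eq_empty_or_nonempty with hE | hne
  · rw [hE, Finset.card_empty, Nat.cast_zero]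
    positivity
  have hlower : (S.card : ℝ) * (2/3 * ε * α' * C * (n / 2)) <
      ∑ a ∈ S, (f a).d * routedLen f ψ a := by
    rw [← nsmul_eq_mul, ← Finset.sum_const]
    refine Finset.sum_lt_sum_of_nonempty hne fun a ha => ?_
    obtain ⟨hd, hl⟩ := (Finset.mem_filter.mp ha).2
    exact mul_lt_mul hd hl (by positivity) (f a).hd.le
  have hsub : ∑ a ∈ S, (f a).d * routedLen f ψ a ≤ ∑ a, (f a).d * routedLen f ψ a :=
    Finset.sum_le_sum_of_subset_of_nonneg (Finset.subset_univ S)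
      fun a _ _ => mul_nonneg (f a).hd.le (Nat.cast_nonneg _)
  have hupper : ∑ a, (f a).d * routedLen f ψ a ≤ α' * (C * n) := by
    rw [← sum_edgeLoad f hψ, hC, div_mul_cancel₀ _ hn0.ne', Finset.mul_sum]
    exact Finset.sum_le_sum fun e _ => hload e
  have hlt : (α' * C * n) * (S.card * ε / 3) < (α' * C * n) * 1 := by
    linarith
  have := lt_of_mul_lt_mul_left hlt (by positivity)
  rw [lt_div_iff₀ hε]
  linarith
end

section
/- Let n ≥ 2, let c be a capacity function on the edges of the bidirected ring on n nodes, let H be a nonempty finite family of demands with D = max over f ∈ H of d(f), let w assign a nonnegative widening cost w(e) ≥ 0 to every edge e, and let 0 ≤ α < 1. Suppose γ assigns a nonnegative real γ(e) ≥ 0 to every edge e and there exists a fractional routing φ of H whose load on every edge e is at most (γ(e) + c(e))·(1−α). Then there exist γ' with γ'(e) ≥ 0 for every edge e and an integral routing of H whose load on every edge e is at most (γ'(e) + c(e))·(1−α), such that Σ_e γ'(e)·w(e) ≤ Σ_e γ(e)·w(e) + (3D/(2(1−α)))·Σ_e w(e), all sums running over all 2n edges. -/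
open Finset

/-- The last node of the forward path of a demand, lifted to `ℕ` along the ring cut at `0`. -/
def fwdEnd {n : ℕ} (g : Demand n) : ℕ := g.s.val + (g.t - g.s).val

theorem onFwdPath_iff_s11 {n : ℕ} [NeZero n] (g : Demand n) (i : ZMod n) :
    OnFwdPath n g.s g.t i ↔ (g.s.val ≤ i.val ∧ i.val < fwdEnd g) ∨ i.val + n < fwdEnd g := by
  have h1 := ZMod.val_lt i
  have h2 := ZMod.val_lt g.s
  have h3 := ZMod.val_lt (g.t - g.s)
  unfold OnFwdPath fwdEnd
  rcases le_or_gt g.s.val i.val with h | h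
  · rw [ZMod.val_sub h]
    omega
  · have h4 : (i - g.s).val + g.s.val = i.val + n := by
      have h5 : (g.s - i).val = g.s.val - i.val := ZMod.val_sub h.le
      have h6 : g.s - i ≠ 0 := by
        intro h0
        rw [h0, ZMod.val_zero] at h5
        omega
      have h7 : (i - g.s).val = n - (g.s - i).val := by
        have : NeZero (g.s - i) := ⟨h6⟩
        rw [← neg_sub, ZMod.val_neg_of_ne_zero]
      omega
    omega

theorem edgeLoad_true {n : ℕ} {ι : Type*} [Fintype ι] (f : ι → Demand n) (φ : ι → ℝ)
    (i : ZMod n) : edgeLoad f φ (true, i) =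
      ∑ a, (if OnFwdPath n (f a).s (f a).t i then φ a * (f a).d else 0) := rfl

theorem edgeLoad_false {n : ℕ} {ι : Type*} [Fintype ι] (f : ι → Demand n) (φ : ι → ℝ)
    (i : ZMod n) : edgeLoad f φ (false, i) =
      ∑ a, (if OnFwdPath n (f a).s (f a).t i then 0 else (1 - φ a) * (f a).d) := by
  refine Finset.sum_congr rfl fun a _ => ?_
  by_cases h : OnFwdPath n (f a).s (f a).t i
  · have h' : ¬ OnBwdPath n (f a).s (f a).t i := not_le.mpr h
    simp [h, h']
  · have h' : OnBwdPath n (f a).s (f a).t i := not_lt.mp h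
    simp [h, h']

/-- Moving `δ` units of demand `b` to its backward path and `δ` units of demand `a` to its
forward path increases no load if the forward path of `a` is contained in that of `b`. -/
theorem edgeLoad_shift_le {n : ℕ} {ι : Type*} [Fintype ι] [DecidableEq ι] (f : ι → Demand n)
    (φ : ι → ℝ) {a b : ι} (hab : a ≠ b)
    (hsub : ∀ i, OnFwdPath n (f a).s (f a).t i → OnFwdPath n (f b).s (f b).t i)
    {δ : ℝ} (hδ : 0 ≤ δ) (e : RingEdge n) :
    edgeLoad f (Function.update (Function.update φ a (φ a + δ / (f a).d)) b
      (φ b - δ / (f b).d)) e ≤ edgeLoad f φ e := by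
  have ha := (f a).hd.ne'
  have hb := (f b).hd.ne'
  set φ' := Function.update (Function.update φ a (φ a + δ / (f a).d)) b (φ b - δ / (f b).d)
  have hva : φ' a = φ a + δ / (f a).d := by simp [φ', hab]
  have hvb : φ' b = φ b - δ / (f b).d := by simp [φ']
  have hvc : ∀ c, c ≠ a ∧ c ≠ b → φ' c = φ c := fun c hc => by simp [φ', hc.1, hc.2]
  have hda : φ' a * (f a).d = φ a * (f a).d + δ := by rw [hva]; field_simp
  have hdb : φ' b * (f b).d = φ b * (f b).d - δ := by rw [hvb]; field_simp
  rw [← sub_nonpos]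
  obtain ⟨_ | _, i⟩ := e
  · rw [edgeLoad_false, edgeLoad_false, ← Finset.sum_sub_distrib,
      Fintype.sum_eq_add a b hab (fun c hc => by rw [hvc c hc, sub_self])]
    have := hsub i
    split_ifs <;> first | linarith | tauto
  · rw [edgeLoad_true, edgeLoad_true, ← Finset.sum_sub_distrib,
      Fintype.sum_eq_add a b hab (fun c hc => by rw [hvc c hc, sub_self])]
    have := hsub i
    split_ifs <;> first | linarith | tauto

/-- Every fractional routing can be changed, without increasing any load, into one whose split
demands have pairwise non-nested forward paths. -/
theorem exists_routing_split_not_nested {n : ℕ} {ι : Type*} [Fintype ι] (f : ι → Demand n)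
    (φ : ι → ℝ) (hφ : IsFracRouting φ) :
    ∃ φ' : ι → ℝ, IsFracRouting φ' ∧ (∀ e, edgeLoad f φ' e ≤ edgeLoad f φ e) ∧
      ∀ a b, a ≠ b → IsSplit φ' a → IsSplit φ' b →
        ¬ ∀ i, OnFwdPath n (f a).s (f a).t i → OnFwdPath n (f b).s (f b).t i := by
  classical
  induction hk : #{a | IsSplit φ a} using Nat.strong_induction_on generalizing φ with
  | _ k ih =>
    by_cases H : ∀ a b, a ≠ b → IsSplit φ a → IsSplit φ b →
        ¬ ∀ i, OnFwdPath n (f a).s (f a).t i → OnFwdPath n (f b).s (f b).t i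
    · exact ⟨φ, hφ, fun _ => le_rfl, H⟩
    push Not at H
    obtain ⟨a, b, hab, hsa, hsb, hsub⟩ := H
    have hda := (f a).hd
    have hdb := (f b).hd
    set δ := min ((1 - φ a) * (f a).d) (φ b * (f b).d) with hδdef
    have hδa : δ / (f a).d ≤ 1 - φ a := (div_le_iff₀ hda).2 (min_le_left _ _)
    have hδb : δ / (f b).d ≤ φ b := (div_le_iff₀ hdb).2 (min_le_right _ _)
    have hδ : 0 ≤ δ :=
      le_min (mul_nonneg (by linarith [hsa.2]) hda.le) (mul_nonneg hsb.1.le hdb.le)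
    have hδa0 : 0 ≤ δ / (f a).d := div_nonneg hδ hda.le
    have hδb0 : 0 ≤ δ / (f b).d := div_nonneg hδ hdb.le
    have hload := edgeLoad_shift_le f φ hab hsub hδ
    set φ' := Function.update (Function.update φ a (φ a + δ / (f a).d)) b (φ b - δ / (f b).d)
    have hva : φ' a = φ a + δ / (f a).d := by simp [φ', hab]
    have hvb : φ' b = φ b - δ / (f b).d := by simp [φ']
    have hvc : ∀ c, c ≠ a → c ≠ b → φ' c = φ c := fun c h1 h2 => by simp [φ', h1, h2]
    have hfrac : IsFracRouting φ' := by
      intro c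
      by_cases hca : c = a
      · rw [hca, hva]
        exact ⟨by linarith [hsa.1], by linarith⟩
      by_cases hcb : c = b
      · rw [hcb, hvb]
        exact ⟨by linarith, by linarith [hsb.2]⟩
      rw [hvc c hca hcb]
      exact hφ c
    have hunsplit : ¬ IsSplit φ' a ∨ ¬ IsSplit φ' b := by
      rcases min_choice ((1 - φ a) * (f a).d) (φ b * (f b).d) with h | h
      · left
        rintro ⟨-, h1⟩
        rw [hva, hδdef, h, mul_div_cancel_right₀ _ hda.ne'] at h1
        linarith
      · right
        rintro ⟨h1, -⟩
        rw [hvb, hδdef, h, mul_div_cancel_right₀ _ hdb.ne'] at h1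
        linarith
    have hlt : #{c | IsSplit φ' c} < k := by
      rw [← hk]
      apply Finset.card_lt_card
      rw [Finset.ssubset_iff_of_subset]
      · rcases hunsplit with h | h
        · exact ⟨a, by simpa using hsa, by simpa using h⟩
        · exact ⟨b, by simpa using hsb, by simpa using h⟩
      · intro c hc
        simp only [Finset.mem_filter, Finset.mem_univ, true_and] at hc ⊢
        by_cases hca : c = a
        · rwa [hca]
        by_cases hcb : c = b
        · rwa [hcb]
        unfold IsSplit at hc ⊢
        rwa [hvc c hca hcb] at hc
    obtain ⟨φ'', h1, h2, h3⟩ := ih _ hlt φ' hfrac rfl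
    exact ⟨φ'', h1, fun e => (h2 e).trans (hload e), h3⟩

/-- Greedy rounding: a family of fractions weighted by `d ≤ D` can be rounded so that the error
accumulated over each initial segment is at most `D / 2`. -/
theorem exists_rounding_initial_segments {ι : Type*} (d φ : ι → ℝ) {D : ℝ}
    (hD : 0 ≤ D) (hdD : ∀ a, d a ≤ D) (hφd : ∀ a, 0 ≤ φ a * d a ∧ 0 ≤ (1 - φ a) * d a)
    (S : ι → ℕ) (T : Finset ι) :
    ∃ ψ : ι → ℝ, (∀ a ∉ T, ψ a = φ a) ∧ (∀ a ∈ T, ψ a = 0 ∨ ψ a = 1) ∧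
      ∀ U ⊆ T, (∀ a ∈ U, ∀ b ∈ T, S b ≤ S a → b ∈ U) →
        |∑ a ∈ U, (ψ a - φ a) * d a| ≤ D / 2 := by
  classical
  induction T using Finset.induction_on_max_value S with
  | empty =>
    refine ⟨φ, fun _ _ => rfl, by simp, fun U hU _ => ?_⟩
    rw [Finset.subset_empty.1 hU]
    simpa using div_nonneg hD zero_le_two
  | insert a T haT hmax ih =>
    obtain ⟨ψ, hout, hint, hsum⟩ := ih
    have hT := abs_le.1 (hsum T subset_rfl fun _ _ _ hb _ => hb)
    obtain ⟨v, hv, hbound⟩ : ∃ v : ℝ, (v = 0 ∨ v = 1) ∧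
        |(v - φ a) * d a + ∑ c ∈ T, (ψ c - φ c) * d c| ≤ D / 2 := by
      have hda := hdD a
      obtain ⟨hlo, hhi⟩ := hφd a
      rcases le_or_gt ((1 - φ a) * d a + ∑ c ∈ T, (ψ c - φ c) * d c) (D / 2) with h | h
      · exact ⟨1, Or.inr rfl, abs_le.2 ⟨by linarith, h⟩⟩
      · exact ⟨0, Or.inl rfl, abs_le.2 ⟨by linarith, by linarith⟩⟩
    have hupd : ∀ c ∈ T, Function.update ψ a v c = ψ c := fun c hc =>
      Function.update_of_ne (ne_of_mem_of_not_mem hc haT) _ _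
    refine ⟨Function.update ψ a v, fun c hc => ?_, fun c hc => ?_, fun U hU hdown => ?_⟩
    · rw [Finset.mem_insert, not_or] at hc
      rw [Function.update_of_ne hc.1, hout c hc.2]
    · rcases Finset.mem_insert.1 hc with rfl | hc
      · simpa using hv
      · rw [hupd c hc]
        exact hint c hc
    · by_cases haU : a ∈ U
      · have hUeq : U = insert a T := hU.antisymm fun c hc => hdown a haU c hc <| by
          rcases Finset.mem_insert.1 hc with rfl | hc
          · exact le_rfl
          · exact hmax c hc
        rw [hUeq, Finset.sum_insert haT, Function.update_self,
          Finset.sum_congr rfl fun c hc => by rw [hupd c hc]]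
        exact hbound
      · have hUT : U ⊆ T := (Finset.subset_insert_iff_of_notMem haU).1 hU
        rw [Finset.sum_congr rfl fun c hc => by rw [hupd c (hUT hc)]]
        exact hsum U hUT fun c hc b hb => hdown c hc b (Finset.mem_insert_of_mem hb)

/-- Every fractional routing can be rounded to an integral one, increasing each load by at most
`3 / 2` times the largest demand. -/
theorem exists_intRouting_edgeLoad_le {n : ℕ} [NeZero n] {ι : Type*} [Fintype ι]
    (f : ι → Demand n) {D : ℝ} (hD : 0 ≤ D) (hdD : ∀ a, (f a).d ≤ D)
    (φ : ι → ℝ) (hφ : IsFracRouting φ) :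
    ∃ ψ : ι → ℝ, IsIntRouting ψ ∧ ∀ e, edgeLoad f ψ e ≤ edgeLoad f φ e + 3 * D / 2 := by
  classical
  obtain ⟨φ', hφ', hle, hnest⟩ := exists_routing_split_not_nested f φ hφ
  set T : Finset ι := {a | IsSplit φ' a} with hT
  have hmemT : ∀ a, a ∈ T ↔ IsSplit φ' a := by simp [hT]
  obtain ⟨ψ, hout, hint, hsum⟩ :=
    exists_rounding_initial_segments (fun a => (f a).d) φ' hD hdD
      (fun a => ⟨mul_nonneg (hφ' a).1 (f a).hd.le,
        mul_nonneg (sub_nonneg.2 (hφ' a).2) (f a).hd.le⟩) (fun a => (f a).s.val) T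
  refine ⟨ψ, fun a => ?_, fun e => le_trans ?_ (add_le_add_left (hle e) _)⟩
  · by_cases ha : a ∈ T
    · exact hint a ha
    · rw [hout a ha]
      obtain ⟨h0, h1⟩ := hφ' a
      rw [hmemT, IsSplit, not_and, not_lt] at ha
      rcases h0.eq_or_lt with h | h
      · exact Or.inl h.symm
      · exact Or.inr (h1.antisymm (ha h))
  have hmono : ∀ a ∈ T, ∀ b ∈ T, (f b).s.val ≤ (f a).s.val → fwdEnd (f b) ≤ fwdEnd (f a) := by
    intro a ha b hb hs
    by_contra! hlt
    refine hnest a b ?_ ((hmemT a).1 ha) ((hmemT b).1 hb) fun i hi => ?_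
    · rintro rfl
      exact hlt.false
    · rw [onFwdPath_iff_s11] at hi ⊢
      omega
  have hwrap : ∀ a ∈ T, ∀ b ∈ T, fwdEnd (f b) ≤ fwdEnd (f a) + n := by
    intro a ha b hb
    by_contra! hlt
    refine hnest a b ?_ ((hmemT a).1 ha) ((hmemT b).1 hb) fun i hi => ?_
    · rintro rfl
      omega
    · rw [onFwdPath_iff_s11] at hi ⊢
      omega
  obtain ⟨o, i⟩ := e
  set x : ι → ℝ := fun a => (ψ a - φ' a) * (f a).d with hx
  have hstart := abs_le.1 <| hsum {a ∈ T | (f a).s.val ≤ i.val} (Finset.filter_subset _ _)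
    fun a ha b hb hs => by
      rw [Finset.mem_filter] at ha ⊢
      exact ⟨hb, hs.trans ha.2⟩
  have hend : ∀ j : ℕ, |∑ a ∈ T with fwdEnd (f a) ≤ j, x a| ≤ D / 2 := fun j =>
    hsum _ (Finset.filter_subset _ _) fun a ha b hb hs => by
      rw [Finset.mem_filter] at ha ⊢
      exact ⟨hb, (hmono a ha.1 b hb hs).trans ha.2⟩
  have htot := abs_le.1 <| hsum T subset_rfl fun _ _ _ hb _ => hb
  have hend1 := abs_le.1 (hend i.val)
  have hend2 := abs_le.1 (hend (i.val + n))
  have hdecomp : ∑ a ∈ T with OnFwdPath n (f a).s (f a).t i, x a =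
      ∑ a ∈ T with (f a).s.val ≤ i.val, x a - ∑ a ∈ T with fwdEnd (f a) ≤ i.val, x a
        + ∑ a ∈ T, x a - ∑ a ∈ T with fwdEnd (f a) ≤ i.val + n, x a := by
    simp only [Finset.sum_filter, ← Finset.sum_sub_distrib, ← Finset.sum_add_distrib]
    refine Finset.sum_congr rfl fun a _ => ?_
    have hse : (f a).s.val ≤ fwdEnd (f a) := Nat.le_add_right _ _
    have hes : fwdEnd (f a) < (f a).s.val + n := Nat.add_lt_add_left (ZMod.val_lt _) _
    have hsn := ZMod.val_lt (f a).s
    simp only [onFwdPath_iff_s11]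
    split_ifs <;> first | omega | ring
  have hcase : ∑ a ∈ T with fwdEnd (f a) ≤ i.val, x a = 0 ∨
      ∑ a ∈ T with fwdEnd (f a) ≤ i.val + n, x a = ∑ a ∈ T, x a := by
    by_cases h : ∀ a ∈ T, fwdEnd (f a) ≤ i.val + n
    · right
      rw [Finset.filter_true_of_mem h]
    · left
      push Not at h
      obtain ⟨a, ha, hai⟩ := h
      rw [Finset.filter_false_of_mem, Finset.sum_empty]
      intro b hb
      have := hwrap b hb a ha
      omega
  cases o
  · have hdiff : edgeLoad f ψ (false, i) - edgeLoad f φ' (false, i) =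
        ∑ a ∈ T with OnFwdPath n (f a).s (f a).t i, x a - ∑ a ∈ T, x a := by
      rw [edgeLoad_false, edgeLoad_false, ← Finset.sum_sub_distrib, Finset.sum_filter,
        ← Finset.sum_sub_distrib]
      symm
      refine Finset.sum_subset_zero_on_sdiff (Finset.subset_univ T) (fun a ha => ?_)
        (fun a _ => ?_)
      · rw [hout a (Finset.mem_sdiff.1 ha).2, sub_self]
      · simp only [hx]
        split_ifs <;> ring
    rcases hcase with h | h <;> linarith
  · have hdiff : edgeLoad f ψ (true, i) - edgeLoad f φ' (true, i) =
        ∑ a ∈ T with OnFwdPath n (f a).s (f a).t i, x a := by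
      rw [edgeLoad_true, edgeLoad_true, ← Finset.sum_sub_distrib, Finset.sum_filter]
      symm
      refine Finset.sum_subset_zero_on_sdiff (Finset.subset_univ T) (fun a ha => ?_)
        (fun a _ => ?_)
      · rw [hout a (Finset.mem_sdiff.1 ha).2, sub_self]
      · simp only [hx]
        split_ifs <;> ring
    rcases hcase with h | h <;> linarith

/-- Network design. If `γ ≥ 0` admits a fractional routing with load at
most `(γ(e) + c(e))·(1-α)` on every edge, then there are `γ' ≥ 0` and an integral routing
with load at most `(γ'(e) + c(e))·(1-α)` on every edge such that
`Σ γ'(e)·w(e) ≤ Σ γ(e)·w(e) + (3D/(2(1-α)))·Σ w(e)`. -/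
theorem stmt11 (n : ℕ) (hn : 2 ≤ n) [NeZero n] (c : RingEdge n → ℝ) (hc : ∀ e, 0 ≤ c e)
    {ι : Type*} [Fintype ι] [Nonempty ι] (f : ι → Demand n)
    (w : RingEdge n → ℝ) (hw : ∀ e, 0 ≤ w e)
    (α : ℝ) (hα0 : 0 ≤ α) (hα1 : α < 1)
    (γ : RingEdge n → ℝ) (hγ : ∀ e, 0 ≤ γ e)
    (φ : ι → ℝ) (hφ : IsFracRouting φ)
    (hload : ∀ e, edgeLoad f φ e ≤ (γ e + c e) * (1 - α)) :
    let D : ℝ := Finset.univ.sup' Finset.univ_nonempty fun a => (f a).d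
    ∃ γ' : RingEdge n → ℝ, (∀ e, 0 ≤ γ' e) ∧
      (∃ ψ : ι → ℝ, IsIntRouting ψ ∧ ∀ e, edgeLoad f ψ e ≤ (γ' e + c e) * (1 - α)) ∧
      ∑ e, γ' e * w e ≤ ∑ e, γ e * w e + 3 * D / (2 * (1 - α)) * ∑ e, w e := by
  intro D
  have hdD : ∀ a, (f a).d ≤ D := fun a =>
    Finset.le_sup' (fun a => (f a).d) (Finset.mem_univ a)
  have hD : 0 ≤ D := (f (Classical.arbitrary ι)).hd.le.trans (hdD _)
  have hα : 0 < 1 - α := sub_pos.2 hα1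
  obtain ⟨ψ, hψ, hψload⟩ := exists_intRouting_edgeLoad_le f hD hdD φ hφ
  refine ⟨fun e => γ e + 3 * D / (2 * (1 - α)), fun e => ?_, ⟨ψ, hψ, fun e => ?_⟩, ?_⟩
  · have := hγ e
    positivity
  · have hextra : 3 * D / (2 * (1 - α)) * (1 - α) = 3 * D / 2 := by field_simp
    linarith [hψload e, hload e]
  · simp only [add_mul, Finset.sum_add_distrib, ← Finset.mul_sum]
    exact le_rfl
end
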